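/- Let b be an odd positive integer, let s ∈ {+1, −1}, and suppose that m := 27b² + 4s is squarefree. Set a := 3b and let ε := (3a² + 2s)/2 + (a/2)·√(3m), a unit of the ring of integers of ℚ(√(3m)). Then ε is not a cube in ℚ(√(3m)): there is no ξ ∈ ℚ(√(3m)) with ξ³ = ε. Equivalently, there is no element ξ of the ring of integers of ℚ(√(3m)) with ξ³ = 3·(3a + √(3m)). -/

import Mathlib

open NumberField IntermediateField

/-- The real quadratic field `ℚ(√d) ⊂ ℝ` for an integer `d`. -/
noncomputable def QsqrtZ (d : ℤ) : IntermediateField ℚ ℝ := ℚ⟮(Real.sqrt (d : ℝ) : ℝ)⟯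

theorem QsqrtZ.exists_rat_add_rat_mul_sqrt {d : ℤ} (hd : 0 ≤ d) {x : ℝ} (hx : x ∈ QsqrtZ d) :
    ∃ u v : ℚ, x = u + v * √(d : ℝ) := by
  have hsq : √(d : ℝ) * √(d : ℝ) = d := Real.mul_self_sqrt (by exact_mod_cast hd)
  have hint : IsIntegral ℚ √(d : ℝ) := by
    refine IsIntegral.of_pow (n := 2) two_pos ?_
    rw [sq, hsq]
    simpa using isIntegral_algebraMap (R := ℚ) (A := ℝ) (x := (d : ℚ))
  rw [QsqrtZ, ← mem_toSubalgebra, adjoin_simple_toSubalgebra_of_isAlgebraic hint.isAlgebraic] at hx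
  induction hx using Algebra.adjoin_induction with
  | mem x hx =>
    rw [Set.mem_singleton_iff] at hx
    exact ⟨0, 1, by simp [hx]⟩
  | algebraMap r => exact ⟨r, 0, by simp⟩
  | add x y _ _ hx hy =>
    obtain ⟨u, v, rfl⟩ := hx
    obtain ⟨u', v', rfl⟩ := hy
    exact ⟨u + u', v + v', by push_cast; ring⟩
  | mul x y _ _ hx hy =>
    obtain ⟨u, v, rfl⟩ := hx
    obtain ⟨u', v', rfl⟩ := hy
    refine ⟨u * u' + v * v' * d, u * v' + v * u', ?_⟩
    push_cast
    linear_combination (v * v' : ℝ) * hsq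

theorem Irrational.rat_add_rat_mul_inj {r : ℝ} (hr : Irrational r) {p q p' q' : ℚ}
    (h : (p + q * r : ℝ) = p' + q' * r) : p = p' ∧ q = q' := by
  have hq : q = q' := by
    by_contra hne
    have hne' : (q - q' : ℝ) ≠ 0 := sub_ne_zero.mpr (by exact_mod_cast hne)
    refine hr ⟨(p' - p) / (q - q'), ?_⟩
    push_cast
    rw [div_eq_iff hne']
    linear_combination -h
  subst hq
  exact ⟨by exact_mod_cast add_right_cancel h, rfl⟩

theorem QsqrtZ.exists_cube_coords {d : ℤ} (hd : 0 ≤ d) (hirr : Irrational √(d : ℝ)) {x : ℝ}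
    (hx : x ∈ QsqrtZ d) {p q : ℚ} (h : x ^ 3 = p + q * √(d : ℝ)) :
    ∃ u v : ℚ, u ^ 3 + 3 * u * v ^ 2 * d = p ∧ 3 * u ^ 2 * v + v ^ 3 * d = q := by
  obtain ⟨u, v, rfl⟩ := exists_rat_add_rat_mul_sqrt hd hx
  have hsq : √(d : ℝ) ^ 2 = d := Real.sq_sqrt (by exact_mod_cast hd)
  refine ⟨u, v, hirr.rat_add_rat_mul_inj ?_⟩
  rw [← h]
  push_cast
  linear_combination -(3 * u * v ^ 2 + v ^ 3 * √(d : ℝ)) * hsq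

theorem Rat.exists_int_of_cube_sub_three_mul {t : ℚ} {c : ℤ} (h : t ^ 3 - 3 * t = c) :
    ∃ n : ℤ, (n : ℚ) = t := by
  have hint : IsIntegral ℤ t := by
    refine ⟨Polynomial.X ^ 3 - Polynomial.C 3 * Polynomial.X - Polynomial.C c, by monicity!, ?_⟩
    simp only [Polynomial.eval₂_sub, Polynomial.eval₂_mul, Polynomial.eval₂_pow,
      Polynomial.eval₂_X, Polynomial.eval₂_C]
    simp [h]
  simpa using IsIntegrallyClosed.isIntegral_iff.mp hint

theorem Rat.cube_sq_ne_sq_108 (N : ℚ) : (N ^ 3) ^ 2 ≠ 108 ^ 2 := by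
  intro h
  have hint : IsIntegral ℤ N := by
    refine IsIntegral.of_pow (n := 6) (by norm_num) ?_
    rw [show N ^ 6 = (N ^ 3) ^ 2 by ring, h]
    exact (isIntegral_algebraMap (R := ℤ) (A := ℚ) (x := 108)).pow 2
  obtain ⟨n, rfl⟩ := IsIntegrallyClosed.isIntegral_iff.mp hint
  have hn : (n ^ 2) ^ 3 = 11664 := by
    have h' : ((n : ℚ) ^ 3) ^ 2 = 108 ^ 2 := by simpa using h
    have h'' : (n ^ 3) ^ 2 = 108 ^ 2 := by exact_mod_cast h'
    linear_combination h''
  have hlo : 22 < n ^ 2 := by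
    by_contra! hle
    have := pow_le_pow_left₀ (sq_nonneg n) hle 3
    omega
  have hhi : n ^ 2 < 23 := by
    by_contra! hle
    have := pow_le_pow_left₀ (by norm_num) hle 3
    omega
  omega

theorem Int.even_of_cube_sub_three_mul {t b s : ℤ} (hs : s ^ 2 = 1) (hb : b ≠ 0)
    (h : t ^ 3 - 3 * t = 27 * b ^ 2 + 2 * s) : Even b := by
  have hfac : (9 * b) ^ 2 = (t + s) ^ 2 * (3 * (t - 2 * s)) := by
    linear_combination -3 * h + (9 * t + 6 * s) * hs
  have hts : t + s ≠ 0 := by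
    intro h0
    rw [h0] at hfac
    simp [hb] at hfac
  obtain ⟨k, hk⟩ := (Int.pow_dvd_pow_iff two_ne_zero).mp ⟨_, hfac⟩
  have hk2 : k ^ 2 = 3 * (t - 2 * s) := by
    refine mul_left_cancel₀ (pow_ne_zero 2 hts) ?_
    rw [← hfac, hk]
    ring
  obtain ⟨c, rfl⟩ := Int.prime_three.dvd_of_dvd_pow ⟨_, hk2⟩
  have hbc : b = (c ^ 2 + s) * c := by
    refine mul_left_cancel₀ (by norm_num : (9 : ℤ) ≠ 0) ?_
    linear_combination hk - c * hk2
  have hs_odd : Odd s := by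
    rw [← Int.odd_pow' two_ne_zero, hs]
    exact odd_one
  rw [hbc, Int.even_mul, Int.even_add, Int.even_pow' two_ne_zero]
  have := Int.not_even_iff_odd.mpr hs_odd
  tauto

theorem irrational_sqrt_three_mul {m : ℤ} (hm : 0 ≤ m) (h3 : ¬ 3 ∣ m) :
    Irrational √((3 * m : ℤ) : ℝ) := by
  rw [irrational_sqrt_intCast_iff]
  refine ⟨?_, by omega⟩
  rintro ⟨r, hr⟩
  obtain ⟨k, rfl⟩ : (3 : ℤ) ∣ r := Int.prime_three.dvd_of_dvd_pow (n := 2) ⟨m, by rw [hr]; ring⟩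
  exact h3 ⟨k ^ 2, by linarith⟩

/-- For odd positive `b`, `s = ±1` and `m = 27b² + 4s` squarefree, with `a = 3b`, the unit
`ε = (3a² + 2s)/2 + (a/2)·√(3m)` of `𝓞_{ℚ(√(3m))}` is not a cube in `ℚ(√(3m))`;
equivalently, no element `ξ` of the ring of integers satisfies `ξ³ = 3(3a + √(3m))`. -/
theorem unit_not_a_cube_of_27b2_plus_4s
    (b : ℤ) (hb_odd : Odd b) (hb_pos : 0 < b)
    (s : ℤ) (hs : s = 1 ∨ s = -1)
    (m : ℤ) (hm : m = 27 * b ^ 2 + 4 * s) (hm_sqfree : Squarefree m)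
    (a : ℤ) (ha : a = 3 * b)
    [NumberField (QsqrtZ (3 * m))] :
    (∀ e : QsqrtZ (3 * m),
      (e : ℝ) = (3 * (a : ℝ) ^ 2 + 2 * (s : ℝ)) / 2
          + ((a : ℝ) / 2) * Real.sqrt ((3 * m : ℤ) : ℝ) →
      ¬ ∃ ξ : QsqrtZ (3 * m), ξ ^ 3 = e) ∧
    (¬ ∃ ξ : 𝓞 (QsqrtZ (3 * m)),
      (((ξ ^ 3 : 𝓞 (QsqrtZ (3 * m))) : QsqrtZ (3 * m)) : ℝ) =
        3 * (3 * (a : ℝ) + Real.sqrt ((3 * m : ℤ) : ℝ))) := by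
  subst ha
  have hs2 : s ^ 2 = 1 := by rcases hs with rfl | rfl <;> norm_num
  have hm_nonneg : 0 ≤ m := by
    have : 1 ≤ b ^ 2 := by nlinarith
    omega
  have hd : 0 ≤ 3 * m := by omega
  have hirr := irrational_sqrt_three_mul hm_nonneg (by omega)
  have hmQ : (m : ℚ) = 27 * b ^ 2 + 4 * s := by exact_mod_cast hm
  have hs2Q : (s : ℚ) ^ 2 = 1 := by exact_mod_cast hs2
  constructor
  · rintro e he ⟨ξ, rfl⟩
    obtain ⟨u, v, hu, hv⟩ := QsqrtZ.exists_cube_coords hd hirr ξ.2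
      (p := (27 * b ^ 2 + 2 * s) / 2) (q := 3 * b / 2) (by
        push_cast at he ⊢
        linear_combination he)
    push_cast at hu hv
    have hN : (u ^ 2 - 3 * m * v ^ 2) ^ 3 = 1 := by
      calc _ = (u ^ 3 + 3 * u * v ^ 2 * (3 * m)) ^ 2
            - 3 * m * (3 * u ^ 2 * v + v ^ 3 * (3 * m)) ^ 2 := by ring
        _ = 1 := by
          rw [hu, hv, hmQ]
          linear_combination hs2Q
    have hN1 : u ^ 2 - 3 * m * v ^ 2 = 1 :=
      (Odd.strictMono_pow (by decide : Odd 3)).injective (by simpa using hN)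
    have ht : (2 * u) ^ 3 - 3 * (2 * u) = ((27 * b ^ 2 + 2 * s : ℤ) : ℚ) := by
      push_cast
      linear_combination 2 * hu + 6 * u * hN1
    obtain ⟨t, htu⟩ := Rat.exists_int_of_cube_sub_three_mul ht
    rw [← htu] at ht
    exact Int.not_even_iff_odd.mpr hb_odd
      (Int.even_of_cube_sub_three_mul hs2 hb_pos.ne' (by exact_mod_cast ht))
  · rintro ⟨ξ, hξ⟩
    obtain ⟨u, v, hu, hv⟩ := QsqrtZ.exists_cube_coords hd hirr (ξ : QsqrtZ (3 * m)).2
      (p := 27 * b) (q := 3) (by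
        push_cast at hξ ⊢
        linear_combination hξ)
    push_cast at hu hv
    have hN : (u ^ 2 - 3 * m * v ^ 2) ^ 3 = -108 * s := by
      calc _ = (u ^ 3 + 3 * u * v ^ 2 * (3 * m)) ^ 2
            - 3 * m * (3 * u ^ 2 * v + v ^ 3 * (3 * m)) ^ 2 := by ring
        _ = -108 * s := by
          rw [hu, hv, hmQ]
          ring
    refine Rat.cube_sq_ne_sq_108 (u ^ 2 - 3 * m * v ^ 2) ?_
    rw [hN]
    linear_combination 108 ^ 2 * hs2Q
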